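/- arXiv:1802.10178 — 3 statements merged into one kernel-verified Lean document; each statement's English description precedes it below -/
import Mathlib

section
/- Let Z = m_0P_0 + m_1P_1 + m_2P_2 be a fat point scheme at three noncollinear points (taken to be the coordinate points) of P^N with m_2 ≥ max(m_0, m_1), m_0 + m_1 > m_2, and m_0 + m_1 + m_2 odd. Then for all positive integers i, k with 1 ≤ i ≤ k − 1 such that i and k − i are not both odd: I(Z)^{(k)} = I(Z)^{(i)} · I(Z)^{(k−i)}. -/
/-- The ideal of the `j`-th coordinate point of `P^N`, generated by all
variables `x_i` with `i ≠ j`. -/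
noncomputable def ptIdeal (K : Type*) [Field K] (N : ℕ) (j : Fin (N + 1)) :
    Ideal (MvPolynomial (Fin (N + 1)) K) :=
  Ideal.span {f | ∃ i : Fin (N + 1), i ≠ j ∧ f = MvPolynomial.X i}

/-- The order of vanishing of the monomial with exponent `e` at the `j`-th coordinate point:
its degree in the variables other than `x_j`. -/
def orderAt {N : ℕ} (j : Fin (N + 1)) (e : Fin (N + 1) →₀ ℕ) : ℕ :=
  ∑ i ∈ Finset.univ.erase j, e i

theorem orderAt_mono {N : ℕ} (j : Fin (N + 1)) : Monotone (orderAt j) :=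
  fun _ _ h => Finset.sum_le_sum fun i _ => h i

theorem orderAt_single_add {N : ℕ} {i j : Fin (N + 1)} (hij : i ≠ j) (e : Fin (N + 1) →₀ ℕ) :
    orderAt j (Finsupp.single i 1 + e) = 1 + orderAt j e := by
  simp [orderAt, Finset.sum_add_distrib, Finsupp.single_apply, hij]

theorem X_mem_ptIdeal (K : Type*) [Field K] {N : ℕ} {i j : Fin (N + 1)} (hij : i ≠ j) :
    MvPolynomial.X i ∈ ptIdeal K N j :=
  Ideal.subset_span ⟨i, hij, rfl⟩

theorem monomial_mem_ptIdeal_pow (K : Type*) [Field K] {N n : ℕ} {j : Fin (N + 1)}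
    {e : Fin (N + 1) →₀ ℕ} (he : n ≤ orderAt j e) (r : K) :
    MvPolynomial.monomial e r ∈ ptIdeal K N j ^ n := by
  refine Ideal.pow_le_pow_right he ?_
  rw [MvPolynomial.monomial_eq, Finsupp.prod_fintype _ _ (fun _ => pow_zero _),
    ← Finset.prod_erase_mul _ _ (Finset.mem_univ j), orderAt, ← Finset.prod_pow_eq_pow_sum]
  refine Ideal.mul_mem_left _ _ (Ideal.mul_mem_right _ _ (Ideal.prod_mem_prod fun i hi => ?_))
  exact Ideal.pow_mem_pow (X_mem_ptIdeal K (Finset.ne_of_mem_erase hi)) _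

theorem ptIdeal_pow_le_span_monomial (K : Type*) [Field K] (N : ℕ) (j : Fin (N + 1)) (n : ℕ) :
    ptIdeal K N j ^ n ≤
      Ideal.span ((fun e => MvPolynomial.monomial e (1 : K)) '' {e | n ≤ orderAt j e}) := by
  induction n with
  | zero =>
    have h : (1 : MvPolynomial (Fin (N + 1)) K) ∈
        (fun e => MvPolynomial.monomial e (1 : K)) '' {e | 0 ≤ orderAt j e} :=
      ⟨0, Nat.zero_le _, rfl⟩
    rw [Ideal.eq_top_of_isUnit_mem _ (Ideal.subset_span h) isUnit_one]
    exact le_top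
  | succ n ih =>
    rw [pow_succ']
    refine (Ideal.mul_mono_right ih).trans ?_
    rw [ptIdeal, Ideal.span_mul_span', Ideal.span_le]
    rintro _ ⟨_, ⟨i, hij, rfl⟩, _, ⟨e, he, rfl⟩, rfl⟩
    refine Ideal.subset_span ⟨Finsupp.single i 1 + e, ?_, ?_⟩
    · have he' : n ≤ orderAt j e := he
      rw [Set.mem_ofPred_eq, orderAt_single_add hij]
      omega
    · simp [MvPolynomial.X, MvPolynomial.monomial_mul]

theorem mem_ptIdeal_pow_iff (K : Type*) [Field K] {N : ℕ} {j : Fin (N + 1)} {n : ℕ}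
    {f : MvPolynomial (Fin (N + 1)) K} :
    f ∈ ptIdeal K N j ^ n ↔ ∀ e ∈ f.support, n ≤ orderAt j e := by
  constructor
  · intro hf e he
    obtain ⟨e', he', hle⟩ := MvPolynomial.mem_ideal_span_monomial_image.mp
      (ptIdeal_pow_le_span_monomial K N j n hf) e he
    exact le_trans he' (orderAt_mono j hle)
  · intro h
    rw [f.as_sum]
    exact Ideal.sum_mem _ fun e he => monomial_mem_ptIdeal_pow K (h e he) _

theorem exists_le_sum_eq {ι : Type*} (S : Finset ι) (g : ι → ℕ) :
    ∀ n ≤ ∑ i ∈ S, g i, ∃ g' ≤ g, ∑ i ∈ S, g' i = n := by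
  classical
  induction S using Finset.induction_on with
  | empty => exact fun n hn => ⟨g, le_rfl, by simpa using (Nat.le_zero.mp hn).symm⟩
  | insert x S hx ih =>
    intro n hn
    rw [Finset.sum_insert hx] at hn
    obtain ⟨g', hle, hsum⟩ := ih (n - min n (g x)) (by omega)
    refine ⟨Function.update g' x (min n (g x)), ?_, ?_⟩
    · exact update_le_iff.mpr ⟨min_le_right _ _, fun y _ => hle y⟩
    · rw [Finset.sum_insert hx, Function.update_self, Finset.sum_update_of_notMem hx, hsum]
      omega

/-- The splitting of exponents for three variables. -/
theorem exists_split_three (A B C A' B' C' a b c : ℤ)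
    (ha : 0 ≤ a) (hb : 0 ≤ b) (hc : 0 ≤ c) (heven : Even (A + B + C))
    (hA : A ≤ B + C) (hB : B ≤ A + C) (hC : C ≤ A + B)
    (hA' : A' ≤ B' + C') (hB' : B' ≤ A' + C') (hC' : C' ≤ A' + B')
    (h0 : A + A' ≤ b + c) (h1 : B + B' ≤ a + c) (h2 : C + C' ≤ a + b) :
    ∃ x y z : ℤ, (0 ≤ x ∧ x ≤ a) ∧ (0 ≤ y ∧ y ≤ b) ∧ (0 ≤ z ∧ z ≤ c) ∧
      (A ≤ y + z ∧ B ≤ x + z ∧ C ≤ x + y) ∧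
      A' ≤ (b - y) + (c - z) ∧ B' ≤ (a - x) + (c - z) ∧ C' ≤ (a - x) + (b - y) := by
  obtain ⟨r, hr⟩ := heven
  obtain ⟨z, hz⟩ : ∃ z : ℤ, (0 ≤ z ∧ B - a ≤ z ∧ A - b ≤ z ∧ B + C' - a - b ≤ z ∧
      A + C' - a - b ≤ z ∧ A + B + C' - a - b ≤ 2 * z) ∧ z ≤ c ∧ z ≤ a + c - B' ∧
      z ≤ b + c - A' ∧ z ≤ a + b + c - A' - C ∧ z ≤ a + b + c - B' - C ∧
      2 * z ≤ a + b + 2 * c - A' - B' - C := by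
    refine ⟨max (max (max 0 (B - a)) (max (A - b) (B + C' - a - b)))
      (max (A + C' - a - b) ((A + B + C' - a - b + 1) / 2)), ?_, ?_⟩
    · omega
    · refine ⟨?_, ?_, ?_, ?_, ?_, ?_⟩ <;> omega
  obtain ⟨x, hx⟩ : ∃ x : ℤ, (0 ≤ x ∧ B - z ≤ x ∧ C - b ≤ x ∧ C - (b + c - A' - z) ≤ x) ∧
      x ≤ a ∧ x ≤ a + c - B' - z ∧ x ≤ a + b - C' ∧ x ≤ a + b - C' - (A - z) := by
    refine ⟨max (max 0 (B - z)) (max (C - b) (C - (b + c - A' - z))), ?_, ?_⟩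
    · omega
    · refine ⟨?_, ?_, ?_, ?_⟩ <;> omega
  refine ⟨x, max (max 0 (A - z)) (C - x), z, ?_⟩
  omega

/-- The splitting of exponents when the total degree `d` in the remaining variables is
taken into account. -/
theorem exists_split_four (A B C A' B' C' : ℤ) (heven : Even (A + B - C))
    (hC : C ≤ A + B) (hAC : A ≤ C) (hBC : B ≤ C)
    (hC' : C' < A' + B') (hAC' : A' ≤ C') (hBC' : B' ≤ C') (d : ℕ) :
    ∀ a b c : ℤ, 0 ≤ a → 0 ≤ b → 0 ≤ c →
      A + A' ≤ b + c + d → B + B' ≤ a + c + d → C + C' ≤ a + b + d →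
    ∃ x y z w : ℤ, ((0 ≤ x ∧ x ≤ a) ∧ (0 ≤ y ∧ y ≤ b) ∧ (0 ≤ z ∧ z ≤ c) ∧ 0 ≤ w ∧ w ≤ d) ∧
      (A ≤ y + z + w ∧ B ≤ x + z + w ∧ C ≤ x + y + w) ∧
      A' ≤ (b - y) + (c - z) + (d - w) ∧ B' ≤ (a - x) + (c - z) + (d - w) ∧
      C' ≤ (a - x) + (b - y) + (d - w) := by
  obtain ⟨r, hr⟩ := heven
  induction d with
  | zero =>
    intro a b c ha hb hc h0 h1 h2
    obtain ⟨x, y, z, h⟩ := exists_split_three A B C A' B' C' a b c ha hb hc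
      ⟨r + C, by omega⟩ (by omega) (by omega) hC (by omega) (by omega) (by omega)
      (by omega) (by omega) (by omega)
    exact ⟨x, y, z, 0, by omega⟩
  | succ d ih =>
    intro a b c ha hb hc h0 h1 h2
    push_cast at *
    by_cases t0 : A + A' < b + c + (d + 1)
    · obtain ⟨x, y, z, w, h⟩ := ih (a + 1) b c (by omega) hb hc (by omega) (by omega) (by omega)
      by_cases hx : x = 0
      · exact ⟨x, y, z, w, by omega⟩
      · exact ⟨x - 1, y, z, w + 1, by omega⟩
    by_cases t1 : B + B' < a + c + (d + 1)
    · obtain ⟨x, y, z, w, h⟩ := ih a (b + 1) c ha (by omega) hc (by omega) (by omega) (by omega)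
      by_cases hy : y = 0
      · exact ⟨x, y, z, w, by omega⟩
      · exact ⟨x, y - 1, z, w + 1, by omega⟩
    by_cases t2 : C + C' < a + b + (d + 1)
    · obtain ⟨x, y, z, w, h⟩ := ih a b (c + 1) ha hb (by omega) (by omega) (by omega) (by omega)
      by_cases hz : z = 0
      · exact ⟨x, y, z, w, by omega⟩
      · exact ⟨x, y, z - 1, w + 1, by omega⟩
    obtain ⟨w, v, hw⟩ : ∃ w v : ℤ, w = 2 * v ∧ 0 ≤ w ∧ w ≤ d + 1 ∧ w ≤ A + B - C ∧
        d + 1 - w ≤ A' + B' - C' := by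
      by_cases hd : A + B - C ≤ d + 1
      · exact ⟨A + B - C, r, by omega⟩
      · exact ⟨2 * ((d + 1) / 2), (d + 1) / 2, by omega⟩
    obtain ⟨x, y, z, h⟩ := exists_split_three (A - w) (B - w) (C - w) (A' - (d + 1 - w))
      (B' - (d + 1 - w)) (C' - (d + 1 - w)) a b c ha hb hc ⟨r + C - 3 * v, by omega⟩
      (by omega) (by omega) (by omega) (by omega) (by omega) (by omega)
      (by omega) (by omega) (by omega)
    exact ⟨x, y, z, w, by omega⟩

theorem exists_orderAt_eq (N : ℕ) (hN : 2 ≤ N) : ∃ S : Finset (Fin (N + 1)),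
    (0 ∉ S ∧ 1 ∉ S ∧ 2 ∉ S) ∧
    ((0 : Fin (N + 1)) ≠ 1 ∧ (0 : Fin (N + 1)) ≠ 2 ∧ (1 : Fin (N + 1)) ≠ 2) ∧
    ∀ e : Fin (N + 1) →₀ ℕ,
      orderAt 0 e = e 1 + e 2 + ∑ i ∈ S, e i ∧ orderAt 1 e = e 0 + e 2 + ∑ i ∈ S, e i ∧
      orderAt 2 e = e 0 + e 1 + ∑ i ∈ S, e i := by
  obtain ⟨M, rfl⟩ := Nat.exists_eq_add_of_le' hN
  have h01 : (0 : Fin (M + 2 + 1)) ≠ 1 := by simp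
  have h02 : (0 : Fin (M + 2 + 1)) ≠ 2 := by
    simp [Fin.ext_iff, Nat.mod_eq_of_lt (show 2 < M + 2 + 1 by omega)]
  have h12 : (1 : Fin (M + 2 + 1)) ≠ 2 := by
    simp [Fin.ext_iff, Nat.mod_eq_of_lt (show 2 < M + 2 + 1 by omega)]
  refine ⟨((Finset.univ.erase 0).erase 1).erase 2, by simp, ⟨h01, h02, h12⟩, fun e => ?_⟩
  have s0 := Finset.add_sum_erase Finset.univ e (Finset.mem_univ 0)
  have s1 := Finset.add_sum_erase Finset.univ e (Finset.mem_univ 1)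
  have s2 := Finset.add_sum_erase Finset.univ e (Finset.mem_univ 2)
  have s01 := Finset.add_sum_erase (Finset.univ.erase 0) e (a := 1) (by simp)
  have s012 := Finset.add_sum_erase ((Finset.univ.erase 0).erase 1) e (a := 2)
    (by simp [h02.symm, h12.symm])
  simp only [orderAt]
  omega

/-- An exponent vanishing to order `A + A'`, `B + B'`, `C + C'` at the three coordinate points
is a sum of exponents vanishing to order `A`, `B`, `C` and `A'`, `B'`, `C'`. -/
theorem exists_add_eq_orderAt {N : ℕ} (hN : 2 ≤ N) {A B C A' B' C' : ℕ}
    (heven : Even ((A : ℤ) + B - C)) (hC : C ≤ A + B) (hAC : A ≤ C) (hBC : B ≤ C)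
    (hC' : C' < A' + B') (hAC' : A' ≤ C') (hBC' : B' ≤ C') (e : Fin (N + 1) →₀ ℕ)
    (h0 : A + A' ≤ orderAt 0 e) (h1 : B + B' ≤ orderAt 1 e) (h2 : C + C' ≤ orderAt 2 e) :
    ∃ f g : Fin (N + 1) →₀ ℕ, f + g = e ∧
      (A ≤ orderAt 0 f ∧ B ≤ orderAt 1 f ∧ C ≤ orderAt 2 f) ∧
      A' ≤ orderAt 0 g ∧ B' ≤ orderAt 1 g ∧ C' ≤ orderAt 2 g := by
  obtain ⟨S, ⟨n0, n1, n2⟩, ⟨h01, h02, h12⟩, hS⟩ := exists_orderAt_eq N hN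
  have he := hS e
  obtain ⟨x, y, z, w, ⟨hx, hy, hz, hw⟩, hf, hg⟩ := exists_split_four A B C A' B' C' heven
    (by omega) (by omega) (by omega) (by omega) (by omega) (by omega) (∑ i ∈ S, e i)
    (e 0) (e 1) (e 2) (by omega) (by omega) (by omega) (by omega) (by omega) (by omega)
  obtain ⟨p, hpe, hp⟩ := exists_le_sum_eq S e w.toNat (by omega)
  let f : Fin (N + 1) →₀ ℕ := Finsupp.equivFunOnFinite.symm
    (Function.update (Function.update (Function.update p 2 z.toNat) 1 y.toNat) 0 x.toNat)
  have f0 : f 0 = x.toNat := by simp [f]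
  have f1 : f 1 = y.toNat := by simp [f, h01.symm]
  have f2 : f 2 = z.toNat := by simp [f, h02.symm, h12.symm]
  have fS : ∑ i ∈ S, f i = w.toNat := by
    simp only [f, Finsupp.coe_equivFunOnFinite_symm]
    rw [Finset.sum_update_of_notMem n0, Finset.sum_update_of_notMem n1,
      Finset.sum_update_of_notMem n2, hp]
  have hfe : f ≤ e := by
    have h2 : Function.update p 2 z.toNat ≤ e :=
      update_le_iff.mpr ⟨by omega, fun i _ => hpe i⟩
    have h1 : Function.update (Function.update p 2 z.toNat) 1 y.toNat ≤ e :=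
      update_le_iff.mpr ⟨by omega, fun i _ => h2 i⟩
    exact Finsupp.coe_le_coe.mp (update_le_iff.mpr ⟨by omega, fun i _ => h1 i⟩)
  obtain ⟨g, rfl⟩ := exists_add_of_le hfe
  have hf' := hS f
  have hg' := hS g
  simp only [Finsupp.add_apply, Finset.sum_add_distrib] at *
  refine ⟨f, g, rfl, ?_⟩
  omega

theorem inf_ptIdeal_pow_eq_mul (K : Type*) [Field K] {N : ℕ} (hN : 2 ≤ N)
    {A B C A' B' C' : ℕ}
    (heven : Even ((A : ℤ) + B - C)) (hC : C ≤ A + B) (hAC : A ≤ C) (hBC : B ≤ C)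
    (hC' : C' < A' + B') (hAC' : A' ≤ C') (hBC' : B' ≤ C') :
    ptIdeal K N 0 ^ (A + A') ⊓ ptIdeal K N 1 ^ (B + B') ⊓ ptIdeal K N 2 ^ (C + C') =
      (ptIdeal K N 0 ^ A ⊓ ptIdeal K N 1 ^ B ⊓ ptIdeal K N 2 ^ C) *
        (ptIdeal K N 0 ^ A' ⊓ ptIdeal K N 1 ^ B' ⊓ ptIdeal K N 2 ^ C') := by
  apply le_antisymm
  · rintro p ⟨⟨hp0, hp1⟩, hp2⟩
    rw [p.as_sum]
    refine Ideal.sum_mem _ fun e he => ?_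
    obtain ⟨f, g, rfl, ⟨f0, f1, f2⟩, g0, g1, g2⟩ := exists_add_eq_orderAt hN heven hC hAC hBC
      hC' hAC' hBC' e ((mem_ptIdeal_pow_iff K).mp hp0 e he)
      ((mem_ptIdeal_pow_iff K).mp hp1 e he) ((mem_ptIdeal_pow_iff K).mp hp2 e he)
    rw [← mul_one (MvPolynomial.coeff (f + g) p), ← MvPolynomial.monomial_mul]
    exact Ideal.mul_mem_mul
      ⟨⟨monomial_mem_ptIdeal_pow K f0 _, monomial_mem_ptIdeal_pow K f1 _⟩,
        monomial_mem_ptIdeal_pow K f2 _⟩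
      ⟨⟨monomial_mem_ptIdeal_pow K g0 _, monomial_mem_ptIdeal_pow K g1 _⟩,
        monomial_mem_ptIdeal_pow K g2 _⟩
  · refine Ideal.mul_le.mpr ?_
    rintro p ⟨⟨hp0, hp1⟩, hp2⟩ q ⟨⟨hq0, hq1⟩, hq2⟩
    rw [pow_add, pow_add, pow_add]
    exact ⟨⟨Ideal.mul_mem_mul hp0 hq0, Ideal.mul_mem_mul hp1 hq1⟩, Ideal.mul_mem_mul hp2 hq2⟩

theorem inf_ptIdeal_pow_eq_mul_of_even (K : Type*) [Field K] {N : ℕ} (hN : 2 ≤ N)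
    {m0 m1 m2 s t : ℕ} (hmax : max m0 m1 ≤ m2) (hgt : m2 < m0 + m1) (hs : Even s) (ht : 0 < t) :
    ptIdeal K N 0 ^ ((s + t) * m0) ⊓ ptIdeal K N 1 ^ ((s + t) * m1) ⊓
        ptIdeal K N 2 ^ ((s + t) * m2) =
      (ptIdeal K N 0 ^ (s * m0) ⊓ ptIdeal K N 1 ^ (s * m1) ⊓ ptIdeal K N 2 ^ (s * m2)) *
        (ptIdeal K N 0 ^ (t * m0) ⊓ ptIdeal K N 1 ^ (t * m1) ⊓ ptIdeal K N 2 ^ (t * m2)) := by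
  obtain ⟨h0, h1⟩ := max_le_iff.mp hmax
  simp only [add_mul]
  apply inf_ptIdeal_pow_eq_mul K hN
  · have : Even (s : ℤ) := (Int.even_coe_nat s).mpr hs
    push_cast
    rw [← mul_add, ← mul_sub]
    exact this.mul_right _
  · rw [← mul_add]
    exact Nat.mul_le_mul_left s hgt.le
  · exact Nat.mul_le_mul_left s h0
  · exact Nat.mul_le_mul_left s h1
  · rw [← mul_add]
    exact Nat.mul_lt_mul_of_pos_left hgt ht
  · exact Nat.mul_le_mul_left t h0
  · exact Nat.mul_le_mul_left t h1

/-- For `Z = m_0 P_0 + m_1 P_1 + m_2 P_2` at the three coordinate points of `P^N`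
with `max(m_0, m_1) ≤ m_2 < m_0 + m_1` and `m_0 + m_1 + m_2` odd: whenever
`1 ≤ i ≤ k − 1` and `i`, `k − i` are not both odd,
`I(Z)^{(k)} = I(Z)^{(i)} · I(Z)^{(k−i)}`. -/
theorem three_points_symbolic_power_splits
    (K : Type*) [Field K] (N : ℕ) (hN : 2 ≤ N) (m0 m1 m2 : ℕ)
    (hmax : max m0 m1 ≤ m2) (hgt : m2 < m0 + m1) (hodd : Odd (m0 + m1 + m2))
    (i k : ℕ) (hi : 1 ≤ i) (hik : i < k) (hpar : ¬(Odd i ∧ Odd (k - i))) :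
    ptIdeal K N 0 ^ (k * m0) ⊓ ptIdeal K N 1 ^ (k * m1) ⊓ ptIdeal K N 2 ^ (k * m2) =
      (ptIdeal K N 0 ^ (i * m0) ⊓ ptIdeal K N 1 ^ (i * m1) ⊓ ptIdeal K N 2 ^ (i * m2)) *
        (ptIdeal K N 0 ^ ((k - i) * m0) ⊓ ptIdeal K N 1 ^ ((k - i) * m1) ⊓
          ptIdeal K N 2 ^ ((k - i) * m2)) := by
  obtain ⟨t, rfl⟩ := Nat.exists_eq_add_of_lt hik
  rw [show i + t + 1 - i = t + 1 by omega, add_assoc] at *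
  rcases Nat.even_or_odd i with h | h
  · exact inf_ptIdeal_pow_eq_mul_of_even K hN hmax hgt h t.succ_pos
  · have ht : Even (t + 1) := Nat.not_odd_iff_even.mp fun ht => hpar ⟨h, ht⟩
    rw [add_comm i, mul_comm (_ ⊓ _ ⊓ _)]
    exact inf_ptIdeal_pow_eq_mul_of_even K hN hmax hgt ht hi
end

section
/- Let Z = m_0P_0 + m_1P_1 + m_2P_2 be a fat point scheme at three noncollinear points (taken to be the coordinate points) of P^N with m_2 ≥ max(m_0, m_1), m_0 + m_1 > m_2, and s = m_0 + m_1 + m_2 odd. Then: (a) I(Z)^{(q(1+s))} ⊆ I(Z)^{q·s} for every q ∈ ℕ; and (b) I(Z)^{(q(1+s)+r)} ⊆ I(Z)^{q·s + r − 1} for every q ∈ ℕ and every integer r with 0 < r < 1 + s. -/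
/-- The monomials of exponents `a, b, c` in `x_0, x_1, x_2` and of degree `d` in the remaining
variables lie in `I(P_0)^m0 ⊓ I(P_1)^m1 ⊓ I(P_2)^m2`. -/
def IsFatExponent (m0 m1 m2 a b c d : ℕ) : Prop :=
  m0 ≤ b + c + d ∧ m1 ≤ a + c + d ∧ m2 ≤ a + b + d

/-- The exponent `(a, b, c, d)` dominates a sum of `t` exponents satisfying `IsFatExponent`. -/
def IsFatSum (m0 m1 m2 : ℕ) : ℕ → ℕ → ℕ → ℕ → ℕ → Prop
  | 0, _, _, _, _ => True
  | t + 1, a, b, c, d => ∃ a₁ a₂ b₁ b₂ c₁ c₂ d₁ d₂ : ℕ,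
      a = a₁ + a₂ ∧ b = b₁ + b₂ ∧ c = c₁ + c₂ ∧ d = d₁ + d₂ ∧
        IsFatExponent m0 m1 m2 a₁ b₁ c₁ d₁ ∧ IsFatSum m0 m1 m2 t a₂ b₂ c₂ d₂

namespace IsFatSum

variable {m0 m1 m2 : ℕ}

theorem add_left {t a b c d : ℕ} (h : IsFatSum m0 m1 m2 t a b c d) (a' b' c' d' : ℕ) :
    IsFatSum m0 m1 m2 t (a' + a) (b' + b) (c' + c) (d' + d) := by
  induction t generalizing a b c d with
  | zero => trivial
  | succ t ih =>
    obtain ⟨a₁, a₂, b₁, b₂, c₁, c₂, d₁, d₂, rfl, rfl, rfl, rfl, hG, h⟩ := h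
    exact ⟨a₁, a' + a₂, b₁, b' + b₂, c₁, c' + c₂, d₁, d' + d₂, by omega, by omega, by omega,
      by omega, hG, ih h⟩

theorem mono {t a b c d a' b' c' d' : ℕ} (h : IsFatSum m0 m1 m2 t a b c d)
    (ha : a ≤ a') (hb : b ≤ b') (hc : c ≤ c') (hd : d ≤ d') :
    IsFatSum m0 m1 m2 t a' b' c' d' := by
  have := h.add_left (a' - a) (b' - b) (c' - c) (d' - d)
  rwa [Nat.sub_add_cancel ha, Nat.sub_add_cancel hb, Nat.sub_add_cancel hc,
    Nat.sub_add_cancel hd] at this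

theorem add {t t' a b c d a' b' c' d' : ℕ} (h : IsFatSum m0 m1 m2 t a b c d)
    (h' : IsFatSum m0 m1 m2 t' a' b' c' d') :
    IsFatSum m0 m1 m2 (t + t') (a + a') (b + b') (c + c') (d + d') := by
  induction t generalizing a b c d with
  | zero => simpa using h'.add_left a b c d
  | succ t ih =>
    obtain ⟨a₁, a₂, b₁, b₂, c₁, c₂, d₁, d₂, rfl, rfl, rfl, rfl, hG, h⟩ := h
    rw [Nat.add_right_comm]
    exact ⟨a₁, a₂ + a', b₁, b₂ + b', c₁, c₂ + c', d₁, d₂ + d', by omega, by omega, by omega,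
      by omega, hG, ih h⟩

/-- If the exponents `(p + x * i + y * j, …)` with `i + j = u` satisfy `IsFatExponent`, then
their analogues with `i + j = t * u` are sums of `t` such exponents. -/
theorem of_affine {u : ℕ} (p₀ x₀ y₀ p₁ x₁ y₁ p₂ x₂ y₂ p₃ x₃ y₃ : ℕ)
    (hG : ∀ i j, i + j = u → IsFatExponent m0 m1 m2 (p₀ + x₀ * i + y₀ * j)
      (p₁ + x₁ * i + y₁ * j) (p₂ + x₂ * i + y₂ * j) (p₃ + x₃ * i + y₃ * j))
    {t i j : ℕ} (hij : i + j = t * u) :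
    IsFatSum m0 m1 m2 t (t * p₀ + x₀ * i + y₀ * j) (t * p₁ + x₁ * i + y₁ * j)
      (t * p₂ + x₂ * i + y₂ * j) (t * p₃ + x₃ * i + y₃ * j) := by
  induction t generalizing i j with
  | zero => trivial
  | succ t ih =>
    obtain ⟨i₁, i₂, j₁, j₂, rfl, rfl, h₁, h₂⟩ :
        ∃ i₁ i₂ j₁ j₂, i = i₁ + i₂ ∧ j = j₁ + j₂ ∧ i₁ + j₁ = u ∧ i₂ + j₂ = t * u := by
      rw [Nat.succ_mul] at hij
      rcases le_total i u with h | h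
      · exact ⟨i, 0, u - i, j - (u - i), by omega, by omega, by omega, by omega⟩
      · exact ⟨u, i - u, 0, j, by omega, by omega, by omega, by omega⟩
    exact ⟨_, _, _, _, _, _, _, _, by ring, by ring, by ring, by ring, hG i₁ j₁ h₁, ih h₂⟩

theorem of_mul {a b c d : ℕ} (hG : IsFatExponent m0 m1 m2 a b c d) (t : ℕ) :
    IsFatSum m0 m1 m2 t (t * a) (t * b) (t * c) (t * d) := by
  simpa using of_affine (u := 0) (i := 0) (j := 0) (t := t) a 0 0 b 0 0 c 0 0 d 0 0
    (fun i j _ => by simpa using hG) (by simp)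

theorem swap_a {t a b c d : ℕ} (h : IsFatSum m0 m1 m2 t (a + 1) b c d) :
    IsFatSum m0 m1 m2 t a b c (d + 1) := by
  induction t generalizing a b c d with
  | zero => trivial
  | succ t ih =>
    obtain ⟨a₁, a₂, b₁, b₂, c₁, c₂, d₁, d₂, ha, rfl, rfl, rfl, ⟨h0, h1, h2⟩, h⟩ := h
    rcases a₂ with _ | a₂
    · exact ⟨a, 0, b₁, b₂, c₁, c₂, d₁ + 1, d₂, by omega, rfl, rfl, by omega,
        ⟨by omega, by omega, by omega⟩, h⟩
    · exact ⟨a₁, a₂, b₁, b₂, c₁, c₂, d₁, d₂ + 1, by omega, rfl, rfl, by omega,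
        ⟨h0, h1, h2⟩, ih h⟩

theorem swap_b {t a b c d : ℕ} (h : IsFatSum m0 m1 m2 t a (b + 1) c d) :
    IsFatSum m0 m1 m2 t a b c (d + 1) := by
  induction t generalizing a b c d with
  | zero => trivial
  | succ t ih =>
    obtain ⟨a₁, a₂, b₁, b₂, c₁, c₂, d₁, d₂, rfl, hb, rfl, rfl, ⟨h0, h1, h2⟩, h⟩ := h
    rcases b₂ with _ | b₂
    · exact ⟨a₁, a₂, b, 0, c₁, c₂, d₁ + 1, d₂, rfl, by omega, rfl, by omega,
        ⟨by omega, by omega, by omega⟩, h⟩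
    · exact ⟨a₁, a₂, b₁, b₂, c₁, c₂, d₁, d₂ + 1, rfl, by omega, rfl, by omega,
        ⟨h0, h1, h2⟩, ih h⟩

theorem swap_c {t a b c d : ℕ} (h : IsFatSum m0 m1 m2 t a b (c + 1) d) :
    IsFatSum m0 m1 m2 t a b c (d + 1) := by
  induction t generalizing a b c d with
  | zero => trivial
  | succ t ih =>
    obtain ⟨a₁, a₂, b₁, b₂, c₁, c₂, d₁, d₂, rfl, rfl, hc, rfl, ⟨h0, h1, h2⟩, h⟩ := h
    rcases c₂ with _ | c₂
    · exact ⟨a₁, a₂, b₁, b₂, c, 0, d₁ + 1, d₂, rfl, rfl, by omega, by omega,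
        ⟨by omega, by omega, by omega⟩, h⟩
    · exact ⟨a₁, a₂, b₁, b₂, c₁, c₂, d₁, d₂ + 1, rfl, rfl, by omega, by omega,
        ⟨h0, h1, h2⟩, ih h⟩

/-- The case of minimal weighted degree `a + b + c + 2 * d`, where only four exponents occur. -/
theorem of_degree_eq {α β γ t a b c d : ℕ}
    (h0 : t * β + t * γ + t ≤ b + c + d) (h1 : t * α + t * γ + t ≤ a + c + d)
    (h2 : t * α + t * β + t ≤ a + b + d)
    (hs : a + b + c + 2 * d = t * α + t * β + t * γ + 2 * t) :
    IsFatSum (β + γ + 1) (α + γ + 1) (α + β + 1) t a b c d := by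
  obtain ⟨x, hx⟩ : ∃ x, a + d + x = t * α + t := ⟨t * α + t - (a + d), by omega⟩
  obtain ⟨y, hy⟩ : ∃ y, b + d + y = t * β + t := ⟨t * β + t - (b + d), by omega⟩
  obtain ⟨z, hz⟩ : ∃ z, c + d + z = t * γ + t := ⟨t * γ + t - (c + d), by omega⟩
  obtain rfl : t = d + x + y + z := by omega
  have hd := of_mul (m0 := β + γ + 1) (m1 := α + γ + 1) (m2 := α + β + 1)
    (a := α) (b := β) (c := γ) (d := 1) ⟨by omega, by omega, by omega⟩ d
  have hx' := of_mul (m0 := β + γ + 1) (m1 := α + γ + 1) (m2 := α + β + 1)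
    (a := α) (b := β + 1) (c := γ + 1) (d := 0) ⟨by omega, by omega, by omega⟩ x
  have hy' := of_mul (m0 := β + γ + 1) (m1 := α + γ + 1) (m2 := α + β + 1)
    (a := α + 1) (b := β) (c := γ + 1) (d := 0) ⟨by omega, by omega, by omega⟩ y
  have hz' := of_mul (m0 := β + γ + 1) (m1 := α + γ + 1) (m2 := α + β + 1)
    (a := α + 1) (b := β + 1) (c := γ) (d := 0) ⟨by omega, by omega, by omega⟩ z
  exact (((hd.add hx').add hy').add hz').mono (by linarith) (by linarith) (by linarith)
    (by linarith)

theorem of_inequalities {α β γ : ℕ} (hα : γ ≤ α) (hβ : γ ≤ β) {t a b c d : ℕ}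
    (h0 : t * β + t * γ + t ≤ b + c + d) (h1 : t * α + t * γ + t ≤ a + c + d)
    (h2 : t * α + t * β + t ≤ a + b + d)
    (hs : t * α + t * β + t * γ + 2 * t ≤ a + b + c + 2 * d) :
    IsFatSum (β + γ + 1) (α + γ + 1) (α + β + 1) t a b c d := by
  induction hn : a + b + c + 2 * d using Nat.strong_induction_on generalizing a b c d with
  | _ n ih =>
  subst hn
  rcases hs.eq_or_lt with hs | hs
  · exact of_degree_eq h0 h1 h2 hs.symm
  rcases d with _ | d
  · rcases a with _ | a
    · exact (of_mul (a := 0) (b := α + β + 1) (c := α + γ + 1) (d := 0)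
        ⟨by omega, by omega, by omega⟩ t).mono (by linarith) (by linarith) (by linarith)
        (by linarith)
    rcases b with _ | b
    · exact (of_mul (a := α + β + 1) (b := 0) (c := β + γ + 1) (d := 0)
        ⟨by omega, by omega, by omega⟩ t).mono (by linarith) (by linarith) (by linarith)
        (by linarith)
    rcases c with _ | c
    · exact (of_mul (a := α + γ + 1) (b := β + γ + 1) (c := 0) (d := 0)
        ⟨by omega, by omega, by omega⟩ t).mono (by linarith) (by linarith) (by linarith)
        (by linarith)
    rcases h0.eq_or_lt with h0' | h0'
    · rcases h1.eq_or_lt with h1' | h1'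
      · exact (of_affine (u := γ) (i := c + 1) (j := t * γ - (c + 1)) (t := t)
          (α + 1) 0 1 (β + 1) 0 1 0 1 0 0 0 0
          (fun i j _ => ⟨by omega, by omega, by omega⟩) (by omega)).mono
          (by rw [mul_add]; omega) (by rw [mul_add]; omega) (by omega) (by omega)
      rcases h2.eq_or_lt with h2' | h2'
      · exact (of_affine (u := β) (i := b + 1) (j := t * β - (b + 1)) (t := t)
          (α + 1) 0 1 0 1 0 (γ + 1) 0 1 0 0 0
          (fun i j _ => ⟨by omega, by omega, by omega⟩) (by omega)).mono
          (by rw [mul_add]; omega) (by omega) (by rw [mul_add]; omega) (by omega)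
      exact (ih _ (by omega) (a := a) (b := b + 1) (c := c + 1) (d := 0) (by omega) (by omega)
        (by omega) (by omega) rfl).mono (by omega) le_rfl le_rfl le_rfl
    rcases h1.eq_or_lt with h1' | h1'
    · rcases h2.eq_or_lt with h2' | h2'
      · exact (of_affine (u := α) (i := a + 1) (j := t * α - (a + 1)) (t := t)
          0 1 0 (β + 1) 0 1 (γ + 1) 0 1 0 0 0
          (fun i j _ => ⟨by omega, by omega, by omega⟩) (by omega)).mono
          (by omega) (by rw [mul_add]; omega) (by rw [mul_add]; omega) (by omega)
      exact (ih _ (by omega) (a := a + 1) (b := b) (c := c + 1) (d := 0) (by omega) (by omega)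
        (by omega) (by omega) rfl).mono le_rfl (by omega) le_rfl le_rfl
    exact (ih _ (by omega) (a := a + 1) (b := b + 1) (c := c) (d := 0) (by omega) (by omega)
      (by omega) (by omega) rfl).mono le_rfl le_rfl (by omega) le_rfl
  · rcases h0.eq_or_lt with h0' | h0'
    · rcases h1.eq_or_lt with h1' | h1'
      · rcases h2.eq_or_lt with h2' | h2'
        · obtain ⟨α, rfl⟩ := Nat.exists_eq_add_of_le hα
          obtain ⟨β, rfl⟩ := Nat.exists_eq_add_of_le hβ
          simp only [mul_add] at h0' h1' h2' hs
          exact (of_affine (u := γ) (i := c) (j := t * γ - c) (t := t)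
            α 1 0 β 1 0 0 1 0 1 0 2
            (fun i j _ => ⟨by omega, by omega, by omega⟩) (by omega)).mono
            (by omega) (by omega) (by omega) (by omega)
        · exact (ih _ (by omega) (a := a) (b := b) (c := c + 1) (d := d) (by omega) (by omega)
            (by omega) (by omega) rfl).swap_c
      · exact (ih _ (by omega) (a := a) (b := b + 1) (c := c) (d := d) (by omega) (by omega)
          (by omega) (by omega) rfl).swap_b
    · exact (ih _ (by omega) (a := a + 1) (b := b) (c := c) (d := d) (by omega) (by omega)
        (by omega) (by omega) rfl).swap_a

/-- Exponents decomposed by `IsFatSum` give products of ideals inside a power of an intersection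
of powers. -/
theorem mul_pow_le {R : Type*} [CommRing R] {A B C J I₀ I₁ I₂ : Ideal R}
    (hA₁ : A ≤ I₁) (hA₂ : A ≤ I₂) (hB₀ : B ≤ I₀) (hB₂ : B ≤ I₂) (hC₀ : C ≤ I₀) (hC₁ : C ≤ I₁)
    (hJ₀ : J ≤ I₀) (hJ₁ : J ≤ I₁) (hJ₂ : J ≤ I₂) {t a b c d : ℕ}
    (h : IsFatSum m0 m1 m2 t a b c d) :
    A ^ a * B ^ b * C ^ c * J ^ d ≤ (I₀ ^ m0 ⊓ I₁ ^ m1 ⊓ I₂ ^ m2) ^ t := by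
  induction t generalizing a b c d with
  | zero => simp
  | succ t ih =>
    obtain ⟨a₁, a₂, b₁, b₂, c₁, c₂, d₁, d₂, rfl, rfl, rfl, rfl, ⟨h0, h1, h2⟩, h⟩ := h
    have key : A ^ a₁ * B ^ b₁ * C ^ c₁ * J ^ d₁ ≤ I₀ ^ m0 ⊓ I₁ ^ m1 ⊓ I₂ ^ m2 := by
      refine le_inf (le_inf ?_ ?_) ?_
      · calc A ^ a₁ * B ^ b₁ * C ^ c₁ * J ^ d₁ ≤ ⊤ * I₀ ^ b₁ * I₀ ^ c₁ * I₀ ^ d₁ := by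
              gcongr; exact le_top
          _ = I₀ ^ (b₁ + c₁ + d₁) := by rw [Ideal.top_mul, pow_add, pow_add]
          _ ≤ _ := Ideal.pow_le_pow_right h0
      · calc A ^ a₁ * B ^ b₁ * C ^ c₁ * J ^ d₁ ≤ I₁ ^ a₁ * ⊤ * I₁ ^ c₁ * I₁ ^ d₁ := by
              gcongr; exact le_top
          _ = I₁ ^ (a₁ + c₁ + d₁) := by rw [Ideal.mul_top, pow_add, pow_add]
          _ ≤ _ := Ideal.pow_le_pow_right h1
      · calc A ^ a₁ * B ^ b₁ * C ^ c₁ * J ^ d₁ ≤ I₂ ^ a₁ * I₂ ^ b₁ * ⊤ * I₂ ^ d₁ := by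
              gcongr; exact le_top
          _ = I₂ ^ (a₁ + b₁ + d₁) := by rw [Ideal.mul_top, pow_add, pow_add]
          _ ≤ _ := Ideal.pow_le_pow_right h2
    calc A ^ (a₁ + a₂) * B ^ (b₁ + b₂) * C ^ (c₁ + c₂) * J ^ (d₁ + d₂)
        = (A ^ a₂ * B ^ b₂ * C ^ c₂ * J ^ d₂) * (A ^ a₁ * B ^ b₁ * C ^ c₁ * J ^ d₁) := by ring
      _ ≤ _ := by rw [pow_succ]; exact Ideal.mul_mono (ih h) key

end IsFatSum

open MvPolynomial in
theorem le_sum_erase_of_mem_ptIdeal_pow {K : Type*} [Field K] {N : ℕ} {j : Fin (N + 1)} {n : ℕ}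
    {f : MvPolynomial (Fin (N + 1)) K} (hf : f ∈ ptIdeal K N j ^ n) {e : Fin (N + 1) →₀ ℕ}
    (he : e ∈ f.support) : n ≤ ∑ i ∈ Finset.univ.erase j, e i := by
  classical
  induction n generalizing f e with
  | zero => simp
  | succ n ih =>
    rw [pow_succ] at hf
    induction hf using Submodule.mul_induction_on' generalizing e with
    | mem_mul_mem g hg h hh =>
      obtain ⟨e₁, h₁, e₂, h₂, rfl⟩ := Finset.mem_add.mp (support_mul g h he)
      have hpt : ptIdeal K N j = Ideal.span (X '' {i | i ≠ j}) := by
        rw [ptIdeal]; congr 1; ext f; simp [eq_comm]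
      rw [hpt, mem_ideal_span_X_image] at hh
      obtain ⟨i, hi, hei⟩ := hh e₂ h₂
      have h₃ : e₂ i ≤ ∑ i ∈ Finset.univ.erase j, e₂ i :=
        Finset.single_le_sum (f := fun i => e₂ i) (fun _ _ => Nat.zero_le _)
          (Finset.mem_erase.mpr ⟨hi, Finset.mem_univ i⟩)
      have h₄ := ih hg h₁
      simp only [Finsupp.add_apply, Finset.sum_add_distrib]
      omega
    | add g _ h _ hg hh =>
      rcases Finset.mem_union.mp (support_add he) with he | he
      exacts [hg he, hh he]

open MvPolynomial in
/-- A containment between an intersection of powers of the point ideals and a power of such an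
intersection can be checked on exponents of monomials. -/
theorem inf_ptIdeal_pow_le {K : Type*} [Field K] {N : ℕ} (hN : 2 ≤ N) {m0 m1 m2 n0 n1 n2 t : ℕ}
    (H : ∀ a b c d, n0 ≤ b + c + d → n1 ≤ a + c + d → n2 ≤ a + b + d →
      IsFatSum m0 m1 m2 t a b c d) :
    ptIdeal K N 0 ^ n0 ⊓ ptIdeal K N 1 ^ n1 ⊓ ptIdeal K N 2 ^ n2 ≤
      (ptIdeal K N 0 ^ m0 ⊓ ptIdeal K N 1 ^ m1 ⊓ ptIdeal K N 2 ^ m2) ^ t := by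
  rintro f ⟨⟨hf0, hf1⟩, hf2⟩
  obtain ⟨N, rfl⟩ := Nat.exists_eq_add_of_le' hN
  have h01 : (0 : Fin (N + 2 + 1)) ≠ 1 := by simp
  have h02 : (0 : Fin (N + 2 + 1)) ≠ 2 := by
    simp [Fin.ext_iff, Nat.mod_eq_of_lt (show 2 < N + 2 + 1 by omega)]
  have h12 : (1 : Fin (N + 2 + 1)) ≠ 2 := by
    simp [Fin.ext_iff, Nat.mod_eq_of_lt (show 2 < N + 2 + 1 by omega)]
  have h1 : (1 : Fin (N + 2 + 1)) ∈ Finset.univ.erase 0 := by simp [h01.symm]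
  have h2 : (2 : Fin (N + 2 + 1)) ∈ (Finset.univ.erase 0).erase 1 := by
    simp [h02.symm, h12.symm]
  set S : Finset (Fin (N + 2 + 1)) := ((Finset.univ.erase 0).erase 1).erase 2 with hS
  rw [as_sum f]
  refine Ideal.sum_mem _ fun e he => ?_
  have hs0 := le_sum_erase_of_mem_ptIdeal_pow hf0 he
  have hs1 := le_sum_erase_of_mem_ptIdeal_pow hf1 he
  have hs2 := le_sum_erase_of_mem_ptIdeal_pow hf2 he
  have e0 := Finset.add_sum_erase Finset.univ (fun i => e i) (Finset.mem_univ 0)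
  have e1 := Finset.add_sum_erase Finset.univ (fun i => e i) (Finset.mem_univ 1)
  have e2 := Finset.add_sum_erase Finset.univ (fun i => e i) (Finset.mem_univ 2)
  have e3 := Finset.add_sum_erase _ (fun i => e i) h1
  have e4 := Finset.add_sum_erase _ (fun i => e i) h2
  rw [← hS] at e4
  have hdec := H (e 0) (e 1) (e 2) (∑ i ∈ S, e i) (by omega) (by omega) (by omega)
  have hX {i j : Fin (N + 2 + 1)} (hij : i ≠ j) :
      (X i : MvPolynomial (Fin (N + 2 + 1)) K) ∈ ptIdeal K (N + 2) j :=
    Ideal.subset_span ⟨i, hij, rfl⟩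
  have hXs {i j : Fin (N + 2 + 1)} (hij : i ≠ j) :
      Ideal.span {(X i : MvPolynomial (Fin (N + 2 + 1)) K)} ≤ ptIdeal K (N + 2) j := by
    simpa [Ideal.span_le] using hX hij
  have hJ (j) (hj : j ∉ S) :
      Ideal.span (X '' (S : Set (Fin (N + 2 + 1)))) ≤ ptIdeal K (N + 2) j := by
    rw [Ideal.span_le]
    rintro _ ⟨i, hi, rfl⟩
    exact hX fun hij => hj (hij ▸ hi)
  refine hdec.mul_pow_le (hXs h01) (hXs h02) (hXs h01.symm) (hXs h12) (hXs h02.symm)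
    (hXs h12.symm) (hJ 0 (by simp [hS])) (hJ 1 (by simp [hS])) (hJ 2 (by simp [hS])) ?_
  rw [monomial_eq, Finsupp.prod_fintype _ _ (by simp),
    ← Finset.mul_prod_erase _ _ (Finset.mem_univ 0), ← Finset.mul_prod_erase _ _ h1,
    ← Finset.mul_prod_erase _ _ h2, ← mul_assoc (X 0 ^ e 0), ← mul_assoc (X 0 ^ e 0 * X 1 ^ e 1)]
  have hX' (i : Fin (N + 2 + 1)) : (X i : MvPolynomial (Fin (N + 2 + 1)) K) ^ e i ∈
      Ideal.span {(X i : MvPolynomial (Fin (N + 2 + 1)) K)} ^ e i :=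
    Ideal.pow_mem_pow (Ideal.mem_span_singleton_self _) _
  refine Ideal.mul_mem_left _ _ (Ideal.mul_mem_mul (Ideal.mul_mem_mul (Ideal.mul_mem_mul
    (hX' 0) (hX' 1)) (hX' 2)) ?_)
  rw [← Finset.prod_pow_eq_pow_sum]
  exact Ideal.prod_mem_prod fun i hi =>
    Ideal.pow_mem_pow (Ideal.subset_span (Set.mem_image_of_mem _ hi)) _

/-- For `Z = m_0 P_0 + m_1 P_1 + m_2 P_2` at the three coordinate points of `P^N`
with `max(m_0, m_1) ≤ m_2 < m_0 + m_1` and `s = m_0 + m_1 + m_2` odd: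
(a) `I(Z)^{(q(1+s))} ⊆ I(Z)^{q·s}` for all `q`;
(b) `I(Z)^{(q(1+s)+r)} ⊆ I(Z)^{q·s+r−1}` for all `q` and `0 < r < 1 + s`. -/
theorem three_points_odd_case_containments
    (K : Type*) [Field K] (N : ℕ) (hN : 2 ≤ N) (m0 m1 m2 : ℕ)
    (hmax : max m0 m1 ≤ m2) (hgt : m2 < m0 + m1) (hodd : Odd (m0 + m1 + m2)) :
    (∀ q : ℕ,
      ptIdeal K N 0 ^ (q * (1 + (m0 + m1 + m2)) * m0) ⊓
          ptIdeal K N 1 ^ (q * (1 + (m0 + m1 + m2)) * m1) ⊓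
          ptIdeal K N 2 ^ (q * (1 + (m0 + m1 + m2)) * m2) ≤
        (ptIdeal K N 0 ^ m0 ⊓ ptIdeal K N 1 ^ m1 ⊓ ptIdeal K N 2 ^ m2) ^
          (q * (m0 + m1 + m2))) ∧
    (∀ q r : ℕ, 0 < r → r < 1 + (m0 + m1 + m2) →
      ptIdeal K N 0 ^ ((q * (1 + (m0 + m1 + m2)) + r) * m0) ⊓
          ptIdeal K N 1 ^ ((q * (1 + (m0 + m1 + m2)) + r) * m1) ⊓
          ptIdeal K N 2 ^ ((q * (1 + (m0 + m1 + m2)) + r) * m2) ≤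
        (ptIdeal K N 0 ^ m0 ⊓ ptIdeal K N 1 ^ m1 ⊓ ptIdeal K N 2 ^ m2) ^
          (q * (m0 + m1 + m2) + r - 1)) := by
  obtain ⟨k, hk⟩ := hodd
  obtain ⟨hm0, hm1⟩ := max_le_iff.mp hmax
  obtain ⟨α, β, γ, hα, hβ, rfl, rfl, rfl⟩ : ∃ α β γ, γ ≤ α ∧ γ ≤ β ∧
      m0 = β + γ + 1 ∧ m1 = α + γ + 1 ∧ m2 = α + β + 1 :=
    ⟨k - m0, k - m1, k - m2, by omega, by omega, by omega, by omega, by omega⟩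
  clear hk hm0 hm1 hmax hgt
  have key (n t : ℕ) (htn : t ≤ n)
      (hs : 2 * (t * (α + β + γ + 2)) ≤ n * (2 * (α + β + γ) + 3) + 1) :
      ptIdeal K N 0 ^ (n * (β + γ + 1)) ⊓ ptIdeal K N 1 ^ (n * (α + γ + 1)) ⊓
          ptIdeal K N 2 ^ (n * (α + β + 1)) ≤
        (ptIdeal K N 0 ^ (β + γ + 1) ⊓ ptIdeal K N 1 ^ (α + γ + 1) ⊓
          ptIdeal K N 2 ^ (α + β + 1)) ^ t := by
    refine inf_ptIdeal_pow_le hN fun a b c d h0 h1 h2 => ?_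
    have h0' := (Nat.mul_le_mul_right (β + γ + 1) htn).trans h0
    have h1' := (Nat.mul_le_mul_right (α + γ + 1) htn).trans h1
    have h2' := (Nat.mul_le_mul_right (α + β + 1) htn).trans h2
    simp only [mul_add, mul_left_comm _ 2] at *
    exact IsFatSum.of_inequalities hα hβ (by omega) (by omega) (by omega) (by omega)
  constructor
  · intro q
    exact key _ _ (Nat.mul_le_mul_left q (by omega)) (by linarith)
  · intro q r hr hrs
    obtain ⟨r, rfl⟩ := Nat.exists_eq_add_of_le' hr
    refine key _ _ ?_ ?_
    · have := Nat.mul_le_mul_left q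
        (Nat.le_add_left (β + γ + 1 + (α + γ + 1) + (α + β + 1)) 1)
      omega
    · rw [← add_assoc, Nat.add_sub_cancel]
      nlinarith
end

section
/- Let Z = m_0P_0 + m_1P_1 + m_2P_2 be a fat point scheme at three noncollinear points (taken to be the coordinate points) of P^N with m_2 ≥ max(m_0, m_1), m_0 + m_1 > m_2, and s = m_0 + m_1 + m_2 odd. Then ρ(I(Z)) ≤ (s+1)/s; more precisely, for all positive integers m, n with m/n ≥ (1+s)/s one has I(Z)^{(m)} ⊆ I(Z)^n. -/
/-- The resurgence `ρ(I) = sup { m/r : I^{(m)} ⊄ I^r }` of an ideal `I` whose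
`m`-th symbolic power is `symb m`. -/
noncomputable def resurgence {R : Type*} [CommRing R] (I : Ideal R) (symb : ℕ → Ideal R) : ℝ :=
  sSup {x : ℝ | ∃ m r : ℕ, 0 < m ∧ 0 < r ∧ ¬ symb m ≤ I ^ r ∧ x = (m : ℝ) / (r : ℝ)}

open MvPolynomial in
/-- Elements of `I(P_j)^k` only involve monomials of degree at least `k` in the variables other
than `x_j`. -/
theorem add_apply_le_degree_of_mem_ptIdeal_pow {K : Type*} [Field K] {N : ℕ} {j : Fin (N + 1)}
    {k : ℕ} {f : MvPolynomial (Fin (N + 1)) K} (hf : f ∈ ptIdeal K N j ^ k)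
    {a : Fin (N + 1) →₀ ℕ} (ha : a ∈ f.support) : k + a j ≤ a.degree := by
  classical
  induction k generalizing f a with
  | zero => simpa using Finsupp.le_degree j a
  | succ k ih =>
    rw [pow_succ] at hf
    induction hf using Submodule.mul_induction_on' generalizing a with
    | mem_mul_mem g hg h hh =>
      obtain ⟨b, hb, c, hc, rfl⟩ := Finset.mem_add.1 (support_mul g h ha)
      have hb' := ih hg hb
      have hset : {f : MvPolynomial (Fin (N + 1)) K | ∃ i : Fin (N + 1), i ≠ j ∧ f = X i} =
          X '' {i | i ≠ j} := by
        ext f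
        simp [eq_comm]
      rw [ptIdeal, hset, mem_ideal_span_X_image] at hh
      obtain ⟨i, hij, hi⟩ := hh c hc
      have hc' : c i + c j ≤ c.degree := by
        have hle : Finsupp.single i (c i) + Finsupp.single j (c j) ≤ c := by
          intro l
          have hij' : i ≠ j := hij
          by_cases h1 : i = l <;> by_cases h2 : j = l <;>
            simp_all
        simpa using Finsupp.degree_mono hle
      have : 0 < c i := Nat.pos_of_ne_zero hi
      rw [Finsupp.add_apply, map_add]
      omega
    | add x hx y hy ihx ihy =>
      rcases Finset.mem_union.1 (support_add ha) with h | h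
      · exact ihx h
      · exact ihy h

open MvPolynomial in
theorem monomial_mem_ptIdeal_pow_s19 {K : Type*} [Field K] {N : ℕ} {j : Fin (N + 1)}
    {k : ℕ} {a : Fin (N + 1) →₀ ℕ} (ha : k + a j ≤ a.degree) :
    monomial a (1 : K) ∈ ptIdeal K N j ^ k := by
  classical
  induction k generalizing a with
  | zero => simp
  | succ k ih =>
    obtain ⟨i, hij, hi⟩ : ∃ i, i ≠ j ∧ a i ≠ 0 := by
      by_contra! h
      have hs : a = Finsupp.single j (a j) := by
        ext i
        by_cases hij : i = j
        · simp [hij]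
        · simp [h i hij, Ne.symm hij]
      have : a.degree = a j := by
        conv_lhs => rw [hs]
        simp
      omega
    have hsplit : a - Finsupp.single i 1 + Finsupp.single i 1 = a :=
      tsub_add_cancel_of_le (Finsupp.single_le_iff.2 (Nat.one_le_iff_ne_zero.2 hi))
    have hdeg := congrArg Finsupp.degree hsplit
    rw [map_add, Finsupp.degree_single] at hdeg
    have hmono : monomial a (1 : K) = monomial (a - Finsupp.single i 1) 1 * X i := by
      rw [X, monomial_mul, hsplit, one_mul]
    rw [hmono, pow_succ]
    refine Ideal.mul_mem_mul (ih ?_) (Ideal.subset_span ⟨i, hij, rfl⟩)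
    have : (a - Finsupp.single i 1 : Fin (N + 1) →₀ ℕ) j = a j := by
      simp [hij]
    omega

theorem Finsupp.add_add_le_degree {σ : Type*} {i j k : σ} (hij : i ≠ j) (hik : i ≠ k)
    (hjk : j ≠ k) (a : σ →₀ ℕ) : a i + a j + a k ≤ a.degree := by
  classical
  have h : Finsupp.single i (a i) + Finsupp.single j (a j) + Finsupp.single k (a k) ≤ a := by
    intro l
    by_cases h1 : i = l <;> by_cases h2 : j = l <;> by_cases h3 : k = l <;>
      simp_all
  simpa using Finsupp.degree_mono h

/-- A subexponent of `a` with prescribed values at three indices and prescribed degree. -/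
theorem Finsupp.exists_le_of_three_values {σ : Type*} {i j k : σ} (hij : i ≠ j) (hik : i ≠ k)
    (hjk : j ≠ k) (a : σ →₀ ℕ) {x y z q : ℕ} (hx : x ≤ a i) (hy : y ≤ a j) (hz : z ≤ a k)
    (hlo : x + y + z ≤ q) (hhi : q + a i + a j + a k ≤ a.degree + x + y + z) :
    ∃ b ≤ a, b i = x ∧ b j = y ∧ b k = z ∧ b.degree = q := by
  classical
  set t : σ →₀ ℕ := Finsupp.single i (a i) + Finsupp.single j (a j) + Finsupp.single k (a k)
    with ht
  have hta : t ≤ a := by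
    intro l
    by_cases h1 : i = l <;> by_cases h2 : j = l <;> by_cases h3 : k = l <;>
      simp_all
  have hdeg := congrArg Finsupp.degree (tsub_add_cancel_of_le hta)
  have htd : t.degree = a i + a j + a k := by simp [ht]
  rw [map_add, htd] at hdeg
  obtain ⟨g, hg, hgd⟩ := Finsupp.exists_le_degree_eq (a - t) (q - (x + y + z)) (by omega)
  have hti : t i = a i := by simp [ht, hij.symm, hik.symm]
  have htj : t j = a j := by simp [ht, hij, hjk.symm]
  have htk : t k = a k := by simp [ht, hik, hjk]
  have hgi : g i = 0 := by simpa [hti] using hg i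
  have hgj : g j = 0 := by simpa [htj] using hg j
  have hgk : g k = 0 := by simpa [htk] using hg k
  refine ⟨Finsupp.single i x + Finsupp.single j y + Finsupp.single k z + g, ?_, ?_, ?_, ?_, ?_⟩
  · intro l
    have := (hg l).trans (Finsupp.tsub_apply a t l ▸ Nat.sub_le _ _)
    by_cases h1 : i = l
    · subst h1
      simpa [hij.symm, hik.symm, hgi] using hx
    by_cases h2 : j = l
    · subst h2
      simpa [hij, hjk.symm, hgj] using hy
    by_cases h3 : k = l
    · subst h3
      simpa [hik, hjk, hgk] using hz
    simpa [Finsupp.single_apply, h1, h2, h3] using this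
  · simp [hij.symm, hik.symm, hgi]
  · simp [hij, hjk.symm, hgj]
  · simp [hik, hjk, hgk]
  · simp [hgd]
    omega

/-- Integers in three given intervals whose sum lies in a fourth. -/
theorem exists_three_mem_Icc_sum_mem_Icc {l₀ l₁ l₂ u₀ u₁ u₂ lo hi : ℤ} (h₀ : l₀ ≤ u₀)
    (h₁ : l₁ ≤ u₁) (h₂ : l₂ ≤ u₂) (h : lo ≤ hi) (hl : l₀ + l₁ + l₂ ≤ hi)
    (hu : lo ≤ u₀ + u₁ + u₂) :
    ∃ x y z : ℤ, (l₀ ≤ x ∧ x ≤ u₀) ∧ (l₁ ≤ y ∧ y ≤ u₁) ∧ (l₂ ≤ z ∧ z ≤ u₂) ∧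
      lo ≤ x + y + z ∧ x + y + z ≤ hi := by
  obtain ⟨T, hT⟩ : ∃ T, T = max lo (l₀ + l₁ + l₂) := ⟨_, rfl⟩
  obtain ⟨x, hx⟩ : ∃ x, x = min u₀ (T - l₁ - l₂) := ⟨_, rfl⟩
  obtain ⟨y, hy⟩ : ∃ y, y = min u₁ (T - x - l₂) := ⟨_, rfl⟩
  exact ⟨x, y, T - x - y, by omega⟩

/-- Splitting off one generator: `A, B, C` are the exponents of `x_0, x_1, x_2`, and `D` the total
degree, of a monomial to be written as a product of `p + 1` generators. -/
theorem exists_generator_exponents {p c m0 m1 m2 A B C D : ℕ} (hc : m0 + m1 + m2 + 1 = 2 * c)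
    (hD : A + B + C ≤ D) (hA : (p + 1) * m0 + A ≤ D) (hB : (p + 1) * m1 + B ≤ D)
    (hC : (p + 1) * m2 + C ≤ D) (hs : (p + 1) * c + (A + B + C) ≤ 2 * D) :
    ∃ x y z q : ℕ, x ≤ A ∧ y ≤ B ∧ z ≤ C ∧ x + y + z ≤ q ∧ q + A + B + C ≤ D + x + y + z ∧
      m0 + x ≤ q ∧ m1 + y ≤ q ∧ m2 + z ≤ q ∧
      p * m0 + q + A ≤ D + x ∧ p * m1 + q + B ≤ D + y ∧ p * m2 + q + C ≤ D + z ∧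
      p * c + 2 * q + (A + B + C) ≤ 2 * D + (x + y + z) := by
  obtain ⟨q, hq⟩ : ∃ q, q = D / (p + 1) := ⟨_, rfl⟩
  have hq1 : p * q + q ≤ D := by
    have := Nat.mul_div_le D (p + 1)
    rw [← hq] at this
    linarith
  have hq2 : D ≤ p * q + q + p := by
    have := Nat.lt_mul_div_succ D (Nat.succ_pos p)
    rw [Nat.succ_eq_add_one, ← hq] at this
    have : (p + 1) * (q + 1) = p * q + q + p + 1 := by ring
    omega
  have hm : ∀ m, (p + 1) * m ≤ D → m ≤ q ∧ p * m ≤ p * q := fun m h => by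
    have : m ≤ q := hq ▸ (Nat.le_div_iff_mul_le (Nat.succ_pos p)).2 (by linarith)
    exact ⟨this, Nat.mul_le_mul_left p this⟩
  have hpair : ∀ m m' : ℕ, (m + m' ≤ q ∧ p * m + p * m' ≤ p * q) ∨
      (q + 1 ≤ m + m' ∧ p * q + p ≤ p * m + p * m') := fun m m' => by
    rcases Nat.lt_or_ge q (m + m') with h | h
    · right
      exact ⟨h, by nlinarith⟩
    · left
      exact ⟨h, by nlinarith⟩
  have hcq : (c ≤ q ∧ p * c ≤ p * q) ∨ (c = q + 1 ∧ p * c = p * q + p) ∨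
      (q + 2 ≤ c ∧ p * q + 2 * p ≤ p * c) := by
    rcases lt_trichotomy c (q + 1) with h | h | h
    · exact Or.inl ⟨by omega, Nat.mul_le_mul_left p (by omega)⟩
    · exact Or.inr (Or.inl ⟨h, by rw [h]; ring⟩)
    · exact Or.inr (Or.inr ⟨h, by nlinarith⟩)
  have hpc : p * m0 + p * m1 + p * m2 + p = 2 * (p * c) := by
    linear_combination p * hc
  have h0 := hm m0 (by omega)
  have h1 := hm m1 (by omega)
  have h2 := hm m2 (by omega)
  have h01 := hpair m0 m1
  have h02 := hpair m0 m2
  have h12 := hpair m1 m2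
  clear hpair hm hq
  simp only [add_mul, one_mul] at hA hB hC hs
  generalize p * m0 = P0 at *
  generalize p * m1 = P1 at *
  generalize p * m2 = P2 at *
  generalize p * c = Pc at *
  generalize p * q = Pq at *
  obtain ⟨x, y, z, hx, hy, hz, hlo, hhi⟩ := exists_three_mem_Icc_sum_mem_Icc
    (l₀ := max 0 (A - (D - q) + P0)) (l₁ := max 0 (B - (D - q) + P1))
    (l₂ := max 0 (C - (D - q) + P2))
    (u₀ := min A (q - m0)) (u₁ := min B (q - m1)) (u₂ := min C (q - m2))
    (lo := max (q - (D - A - B - C)) (A + B + C - 2 * (D - q) + Pc)) (hi := min q (2 * q - c))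
    (by clear hcq h01 h02 h12; omega) (by clear hcq h01 h02 h12; omega)
    (by clear hcq h01 h02 h12; omega)
    (by
      clear h01 h02 h12
      apply max_le <;> apply le_min <;> omega)
    (by
      rcases max_choice (0 : ℤ) (A - (D - q) + P0) with e0 | e0 <;>
      rcases max_choice (0 : ℤ) (B - (D - q) + P1) with e1 | e1 <;>
      rcases max_choice (0 : ℤ) (C - (D - q) + P2) with e2 | e2 <;>
      rw [e0, e1, e2] <;> clear e0 e1 e2 <;> apply le_min <;>
      first
        | (clear h01 h02 h12; omega)
        | (clear hcq h02 h12; omega)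
        | (clear hcq h01 h12; omega)
        | (clear hcq h01 h02; omega))
    (by
      rcases min_choice (A : ℤ) (q - m0) with e0 | e0 <;>
      rcases min_choice (B : ℤ) (q - m1) with e1 | e1 <;>
      rcases min_choice (C : ℤ) (q - m2) with e2 | e2 <;>
      rw [e0, e1, e2] <;> clear e0 e1 e2 <;> apply max_le <;>
      first
        | (clear h01 h02 h12; omega)
        | (clear hcq h02 h12; omega)
        | (clear hcq h01 h12; omega)
        | (clear hcq h01 h02; omega)
        | omega)
  clear hcq h01 h02 h12 h0 h1 h2
  rw [max_le_iff] at hx hy hz hlo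
  rw [le_min_iff] at hx hy hz hhi
  lift x to ℕ using hx.1.1
  lift y to ℕ using hy.1.1
  lift z to ℕ using hz.1.1
  refine ⟨x, y, z, q, ?_, ?_, ?_, ?_, ?_, ?_, ?_, ?_, ?_, ?_, ?_, ?_⟩ <;> omega

theorem Fin.zero_one_two_distinct {N : ℕ} (hN : 2 ≤ N) :
    (0 : Fin (N + 1)) ≠ 1 ∧ (0 : Fin (N + 1)) ≠ 2 ∧ (1 : Fin (N + 1)) ≠ 2 := by
  have h1 : ((1 : Fin (N + 1)) : ℕ) = 1 := Nat.mod_eq_of_lt (a := 1) (by omega)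
  have h2 : ((2 : Fin (N + 1)) : ℕ) = 2 := Nat.mod_eq_of_lt (a := 2) (by omega)
  refine ⟨fun h => ?_, fun h => ?_, fun h => ?_⟩ <;> have := congrArg Fin.val h <;>
    simp only [h1, h2, Fin.val_zero] at this <;> omega

open MvPolynomial in
theorem monomial_mem_three_points_pow {K : Type*} [Field K] {N : ℕ} (hN : 2 ≤ N)
    {m0 m1 m2 c : ℕ} (hc : m0 + m1 + m2 + 1 = 2 * c) {n : ℕ} {a : Fin (N + 1) →₀ ℕ}
    (h0 : n * m0 + a 0 ≤ a.degree) (h1 : n * m1 + a 1 ≤ a.degree)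
    (h2 : n * m2 + a 2 ≤ a.degree) (hs : n * c + (a 0 + a 1 + a 2) ≤ 2 * a.degree) :
    monomial a (1 : K) ∈
      (ptIdeal K N 0 ^ m0 ⊓ ptIdeal K N 1 ^ m1 ⊓ ptIdeal K N 2 ^ m2) ^ n := by
  obtain ⟨h01, h02, h12⟩ := Fin.zero_one_two_distinct hN
  induction n generalizing a with
  | zero => simp
  | succ n ih =>
    obtain ⟨x, y, z, q, hx, hy, hz, hxyz, hq, hx', hy', hz', hA, hB, hC, hD⟩ :=
      exists_generator_exponents hc (Finsupp.add_add_le_degree h01 h02 h12 a) h0 h1 h2 hs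
    obtain ⟨b, hba, rfl, rfl, rfl, rfl⟩ :=
      Finsupp.exists_le_of_three_values h01 h02 h12 a hx hy hz hxyz hq
    obtain ⟨d, rfl⟩ := exists_add_of_le hba
    simp only [Finsupp.add_apply, map_add] at *
    have hmono : monomial (b + d) (1 : K) = monomial d 1 * monomial b 1 := by
      rw [monomial_mul, one_mul, add_comm b d]
    rw [hmono, pow_succ]
    refine Ideal.mul_mem_mul (ih ?_ ?_ ?_ ?_) ⟨⟨?_, ?_⟩, ?_⟩
    · omega
    · omega
    · omega
    · omega
    · exact monomial_mem_ptIdeal_pow_s19 hx'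
    · exact monomial_mem_ptIdeal_pow_s19 hy'
    · exact monomial_mem_ptIdeal_pow_s19 hz'

open MvPolynomial in
theorem three_points_symbolic_power_le {K : Type*} [Field K] {N : ℕ} (hN : 2 ≤ N)
    {m0 m1 m2 : ℕ} (hodd : Odd (m0 + m1 + m2)) {m n : ℕ}
    (hmn : n * (m0 + m1 + m2 + 1) ≤ m * (m0 + m1 + m2)) :
    ptIdeal K N 0 ^ (m * m0) ⊓ ptIdeal K N 1 ^ (m * m1) ⊓ ptIdeal K N 2 ^ (m * m2) ≤
      (ptIdeal K N 0 ^ m0 ⊓ ptIdeal K N 1 ^ m1 ⊓ ptIdeal K N 2 ^ m2) ^ n := by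
  rintro f ⟨⟨hf0, hf1⟩, hf2⟩
  obtain ⟨t, ht⟩ := hodd
  have hnm : n ≤ m := by
    by_contra! h
    nlinarith
  rw [f.as_sum]
  refine Ideal.sum_mem _ fun a ha => ?_
  have h0 := add_apply_le_degree_of_mem_ptIdeal_pow hf0 ha
  have h1 := add_apply_le_degree_of_mem_ptIdeal_pow hf1 ha
  have h2 := add_apply_le_degree_of_mem_ptIdeal_pow hf2 ha
  obtain ⟨h01, h02, h12⟩ := Fin.zero_one_two_distinct hN
  have hdeg := Finsupp.add_add_le_degree h01 h02 h12 a
  have hmono : monomial a (coeff a f) = C (coeff a f) * monomial a 1 := by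
    rw [C_mul_monomial, mul_one]
  rw [hmono]
  refine Ideal.mul_mem_left _ _
    (monomial_mem_three_points_pow hN (c := t + 1) (by omega) ?_ ?_ ?_ ?_)
  · exact le_trans (by gcongr) h0
  · exact le_trans (by gcongr) h1
  · exact le_trans (by gcongr) h2
  · have : n * (m0 + m1 + m2 + 1) = 2 * (n * (t + 1)) := by rw [ht]; ring
    have : m * (m0 + m1 + m2) = m * m0 + m * m1 + m * m2 := by ring
    omega

/-- For `Z = m_0 P_0 + m_1 P_1 + m_2 P_2` at the three coordinate points of `P^N`
with `max(m_0, m_1) ≤ m_2 < m_0 + m_1` and `s = m_0 + m_1 + m_2` odd: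
`ρ(I(Z)) ≤ (s+1)/s`; more precisely, whenever `m/n ≥ (1+s)/s` (for positive `m`, `n`),
`I(Z)^{(m)} ⊆ I(Z)^n`. -/
theorem three_points_resurgence_upper_bound
    (K : Type*) [Field K] (N : ℕ) (hN : 2 ≤ N) (m0 m1 m2 : ℕ)
    (hmax : max m0 m1 ≤ m2) (hgt : m2 < m0 + m1) (hodd : Odd (m0 + m1 + m2)) :
    resurgence (ptIdeal K N 0 ^ m0 ⊓ ptIdeal K N 1 ^ m1 ⊓ ptIdeal K N 2 ^ m2)
        (fun m =>
          ptIdeal K N 0 ^ (m * m0) ⊓ ptIdeal K N 1 ^ (m * m1) ⊓ ptIdeal K N 2 ^ (m * m2)) ≤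
      ((m0 : ℝ) + m1 + m2 + 1) / ((m0 : ℝ) + m1 + m2) ∧
    ∀ m n : ℕ, 0 < m → 0 < n →
      (1 + ((m0 : ℝ) + m1 + m2)) / ((m0 : ℝ) + m1 + m2) ≤ (m : ℝ) / (n : ℝ) →
      ptIdeal K N 0 ^ (m * m0) ⊓ ptIdeal K N 1 ^ (m * m1) ⊓ ptIdeal K N 2 ^ (m * m2) ≤
        (ptIdeal K N 0 ^ m0 ⊓ ptIdeal K N 1 ^ m1 ⊓ ptIdeal K N 2 ^ m2) ^ n := by
  have hs : (0 : ℝ) < (m0 : ℝ) + m1 + m2 := by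
    exact_mod_cast hodd.pos
  have key : ∀ m n : ℕ, 0 < m → 0 < n →
      (1 + ((m0 : ℝ) + m1 + m2)) / ((m0 : ℝ) + m1 + m2) ≤ (m : ℝ) / (n : ℝ) →
      ptIdeal K N 0 ^ (m * m0) ⊓ ptIdeal K N 1 ^ (m * m1) ⊓ ptIdeal K N 2 ^ (m * m2) ≤
        (ptIdeal K N 0 ^ m0 ⊓ ptIdeal K N 1 ^ m1 ⊓ ptIdeal K N 2 ^ m2) ^ n := by
    intro m n _ hn h
    have hn' : (0 : ℝ) < n := by exact_mod_cast hn
    rw [div_le_div_iff₀ hs hn'] at h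
    refine three_points_symbolic_power_le hN hodd ?_
    have : (n : ℝ) * (m0 + m1 + m2 + 1) ≤ m * (m0 + m1 + m2) := by linarith
    exact_mod_cast this
  refine ⟨Real.sSup_le ?_ (by positivity), key⟩
  rintro x ⟨m, r, hm, hr, hnot, rfl⟩
  by_contra! h
  exact hnot (key m r hm hr (by rw [add_comm 1]; exact h.le))
end
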